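/- arXiv:math/0207207 — 2 statements merged into one kernel-verified Lean document; each statement's English description precedes it below -/
import Mathlib

section
/- Let N = 2, let 0 ≠ q ∈ ℂ, and let ξ be the 2×2 matrix with ξ_{12} = ξ₁ ≠ 0 and all other entries zero (a ℂ-point of M_q). Then: (i) the image of β^ξ is the subalgebra of O(GL_q) generated by x_{21}²/det_q, x_{21}x_{22}/det_q, x_{22}²/det_q (in particular, im(β^ξ) is a quantum homogeneous space); (ii) the kernel of β^ξ is the right ideal of O(M_q) generated by τ₁ and τ₂; (i') the image of α^ξ is the same subalgebra ℂ⟨x_{21}²/det_q, x_{21}x_{22}/det_q, x_{22}²/det_q⟩; (ii') the kernel of α^ξ is the left ideal O(M_q)σ₁ + O(M_q)σ₂. -/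
open TensorProduct

noncomputable section

/-- Number of inversions (the length) of a permutation of `Fin t`. -/
def invCount {t : ℕ} (σ : Equiv.Perm (Fin t)) : ℕ :=
  (Finset.univ.filter fun p : Fin t × Fin t => p.1 < p.2 ∧ σ p.2 < σ p.1).card

/-- The principal quantum minor `[I|I]` of the matrix of generators `x`. -/
def qMinor {A : Type} [CommRing A] {M : Type} [Ring M] [Algebra A M] {N : ℕ}
    (q : A) (x : Fin N → Fin N → M) (I : Finset (Fin N)) : M :=
  ∑ σ : Equiv.Perm (Fin I.card),
    ((-q) ^ invCount σ) •
      ((List.finRange I.card).map fun k =>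
        x ((I.orderIsoOfFin rfl) k).1 ((I.orderIsoOfFin rfl) (σ k)).1).prod

/-- The quantum determinant. -/
def qdet {A : Type} [CommRing A] {M : Type} [Ring M] [Algebra A M] {N : ℕ}
    (q : A) (x : Fin N → Fin N → M) : M :=
  qMinor q x Finset.univ

/-- `w(I)`: the sum of the elements of `I` (with `{1, …, N}` indexing). -/
def wtSet {N : ℕ} (I : Finset (Fin N)) : ℕ := ∑ j ∈ I, (j.1 + 1)

/-- The weighted sum `τ_i` of principal quantum minors of size `i`. -/
def tauCoinv {A : Type} [CommRing A] {M : Type} [Ring M] [Algebra A M] {N : ℕ}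
    (q qinv : A) (x : Fin N → Fin N → M) (i : ℕ) : M :=
  ∑ I ∈ Finset.univ.filter (fun I : Finset (Fin N) => I.card = i),
    qinv ^ (2 * wtSet I) • qMinor q x I

/-- The sum `σ_i` of all principal quantum minors of size `i`. -/
def sigmaCoinv {A : Type} [CommRing A] {M : Type} [Ring M] [Algebra A M] {N : ℕ}
    (q : A) (x : Fin N → Fin N → M) (i : ℕ) : M :=
  ∑ I ∈ Finset.univ.filter (fun I : Finset (Fin N) => I.card = i), qMinor q x I

/-- The right adjoint coaction `β(h) = Σ h₂ ⊗ S(h₁)h₃`. -/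
def adjBeta {A : Type} [CommRing A] {M G : Type} [Ring M] [Algebra A M] [Ring G] [Algebra A G]
    (ΔM : M →ₐ[A] M ⊗[A] M) (ι : M →ₐ[A] G) (St : G →ₗ[A] G) : M →ₗ[A] M ⊗[A] G :=
  TensorProduct.map LinearMap.id (LinearMap.mul' A G) ∘ₗ
  (TensorProduct.assoc A M G G).toLinearMap ∘ₗ
  TensorProduct.map
    ((TensorProduct.comm A G M).toLinearMap ∘ₗ
      TensorProduct.map (St ∘ₗ ι.toLinearMap) LinearMap.id)
    ι.toLinearMap ∘ₗ
  TensorProduct.map ΔM.toLinearMap LinearMap.id ∘ₗ ΔM.toLinearMap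

/-- The right coaction `α(h) = Σ h₂ ⊗ h₃S(h₁)`. -/
def adjAlpha {A : Type} [CommRing A] {M G : Type} [Ring M] [Algebra A M] [Ring G] [Algebra A G]
    (ΔM : M →ₐ[A] M ⊗[A] M) (ι : M →ₐ[A] G) (St : G →ₗ[A] G) : M →ₗ[A] M ⊗[A] G :=
  TensorProduct.map LinearMap.id (LinearMap.mul' A G) ∘ₗ
  TensorProduct.map LinearMap.id (TensorProduct.comm A G G).toLinearMap ∘ₗ
  (TensorProduct.assoc A M G G).toLinearMap ∘ₗ
  TensorProduct.map
    ((TensorProduct.comm A G M).toLinearMap ∘ₗ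
      TensorProduct.map (St ∘ₗ ι.toLinearMap) LinearMap.id)
    ι.toLinearMap ∘ₗ
  TensorProduct.map ΔM.toLinearMap LinearMap.id ∘ₗ ΔM.toLinearMap

/-- The co-orbit map associated to a point `e = ev_ξ` and a coaction `b`. -/
def coorbit {A : Type} [CommRing A] {M G : Type} [Ring M] [Algebra A M] [Ring G] [Algebra A G]
    (e : M →ₐ[A] A) (b : M →ₗ[A] M ⊗[A] G) : M →ₗ[A] G :=
  (TensorProduct.lid A G).toLinearMap ∘ₗ TensorProduct.map e.toLinearMap LinearMap.id ∘ₗ b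

/-- The left coaction `λ_D = (π_D ⊗ id) ∘ Δ` of a quotient Hopf algebra. -/
def leftCoact {A : Type} [CommRing A] {G D : Type} [Ring G] [Algebra A G]
    [CommRing D] [Algebra A D]
    (πD : G →ₐ[A] D) (ΔG : G →ₐ[A] G ⊗[A] G) : G →ₗ[A] D ⊗[A] G :=
  TensorProduct.map πD.toLinearMap LinearMap.id ∘ₗ ΔG.toLinearMap

/-- Coinvariants of the left coaction `λ_D`. -/
def dCoinv {A : Type} [CommRing A] {G D : Type} [Ring G] [Algebra A G]
    [CommRing D] [Algebra A D]
    (πD : G →ₐ[A] D) (ΔG : G →ₐ[A] G ⊗[A] G) : Set G :=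
  {f : G | leftCoact πD ΔG f = (1 : D) ⊗ₜ[A] f}

/-- The right coaction `ρ_D = (id ⊗ π_D) ∘ Δ`. -/
def rightCoact {A : Type} [CommRing A] {G D : Type} [Ring G] [Algebra A G]
    [CommRing D] [Algebra A D]
    (πD : G →ₐ[A] D) (ΔG : G →ₐ[A] G ⊗[A] G) : G →ₗ[A] G ⊗[A] D :=
  TensorProduct.map LinearMap.id πD.toLinearMap ∘ₗ ΔG.toLinearMap

/-- The weight space of weight `ta : D` for the grading induced by `ρ_D`. -/
def weightSpace' {A : Type} [CommRing A] {G D : Type} [Ring G] [Algebra A G]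
    [CommRing D] [Algebra A D]
    (πD : G →ₐ[A] D) (ΔG : G →ₐ[A] G ⊗[A] G) (ta : D) : Submodule A G :=
  LinearMap.ker (rightCoact πD ΔG - (TensorProduct.mk A G D).flip ta)

/-- The subcomodule generated by a subset `s` of the comodule `(M, b)`. -/
def comodGen {A : Type} [CommRing A] {M G : Type} [Ring M] [Algebra A M] [Ring G] [Algebra A G]
    (b : M →ₗ[A] M ⊗[A] G) (s : Set M) : Submodule A M :=
  sInf {W : Submodule A M | s ⊆ W ∧
    ∀ w ∈ W, b w ∈ LinearMap.range (TensorProduct.map W.subtype (LinearMap.id : G →ₗ[A] G))}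

section QuasiCommuting

variable {R : Type*} [Ring R] [Algebra ℂ R] {q : ℂ} {x y : R}

theorem mul_pow_of_quasiCommute (h : x * y = q • (y * x)) (n : ℕ) :
    x * y ^ n = q ^ n • (y ^ n * x) := by
  induction n with
  | zero => simp
  | succ n ih =>
    rw [pow_succ y, ← mul_assoc, ih, smul_mul_assoc, mul_assoc, h, mul_smul_comm, smul_smul,
      ← pow_succ, mul_assoc]

theorem pow_mul_of_quasiCommute (h : x * y = q • (y * x)) (n : ℕ) :
    x ^ n * y = q ^ n • (y * x ^ n) := by
  induction n with
  | zero => simp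
  | succ n ih =>
    rw [pow_succ' x, mul_assoc, ih, mul_smul_comm, ← mul_assoc, h, smul_mul_assoc, smul_smul,
      ← pow_succ, mul_assoc]

theorem pow_mul_pow_of_quasiCommute (h : x * y = q • (y * x)) (m n : ℕ) :
    x ^ m * y ^ n = (q ^ n) ^ m • (y ^ n * x ^ m) :=
  pow_mul_of_quasiCommute (mul_pow_of_quasiCommute h n) m

theorem quasiCommute_symm (hq : q ≠ 0) (h : x * y = q • (y * x)) :
    y * x = q⁻¹ • (x * y) := by
  rw [h, smul_smul, inv_mul_cancel₀ hq, one_smul]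

theorem adjoin_le_of_mul_mem {S : Set R} {p : Submodule ℂ R} (h1 : 1 ∈ p)
    (hS : ∀ y ∈ p, ∀ s ∈ S, y * s ∈ p) : Subalgebra.toSubmodule (Algebra.adjoin ℂ S) ≤ p := by
  suffices h : ∀ z ∈ Algebra.adjoin ℂ S, ∀ y ∈ p, y * z ∈ p by
    intro z hz
    simpa using h z hz 1 h1
  intro z hz
  induction hz using Algebra.adjoin_induction with
  | mem s hs => exact fun y hy => hS y hy s hs
  | algebraMap r =>
    intro y hy
    rw [← Algebra.commutes, ← Algebra.smul_def]
    exact p.smul_mem r hy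
  | add u v _ _ hu hv =>
    intro y hy
    rw [mul_add]
    exact p.add_mem (hu y hy) (hv y hy)
  | mul u v _ _ hu hv =>
    intro y hy
    rw [← mul_assoc]
    exact hv _ (hu y hy)

end QuasiCommuting

section EvenMonomials

variable {G : Type*} [Ring G] [Algebra ℂ G] {q : ℂ} {C D u : G}

/-- The degree zero monomials `D ^ l * C ^ m * u ^ n` with `l + m = 2 * n`, where the first
component of the index is the common parity of `l` and `m`. -/
def evenMonomial (C D u : G) (k : Bool × ℕ × ℕ) : G :=
  D ^ (2 * k.2.1 + k.1.toNat) * C ^ (2 * k.2.2 + k.1.toNat) * u ^ (k.2.1 + k.2.2 + k.1.toNat)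

theorem monomial_mul_monomial (hCD : C * D = q • (D * C)) (hC : Commute u C) (hD : Commute u D)
    (l m n l' m' n' : ℕ) :
    (D ^ l * C ^ m * u ^ n) * (D ^ l' * C ^ m' * u ^ n') =
      (q ^ l') ^ m • (D ^ (l + l') * C ^ (m + m') * u ^ (n + n')) := by
  have h1 : u ^ n * (D ^ l' * C ^ m') = D ^ l' * C ^ m' * u ^ n :=
    ((hD.pow_pow n l').mul_right (hC.pow_pow n m')).eq
  calc (D ^ l * C ^ m * u ^ n) * (D ^ l' * C ^ m' * u ^ n')
      = D ^ l * C ^ m * (u ^ n * (D ^ l' * C ^ m')) * u ^ n' := by simp only [mul_assoc]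
    _ = D ^ l * (C ^ m * D ^ l') * C ^ m' * (u ^ n * u ^ n') := by
        rw [h1]; simp only [mul_assoc]
    _ = _ := by
        rw [pow_mul_pow_of_quasiCommute hCD]
        simp only [mul_smul_comm, smul_mul_assoc, pow_add, mul_assoc]

theorem span_evenMonomial (hq : q ≠ 0) (hCD : C * D = q • (D * C)) (hC : Commute u C)
    (hD : Commute u D) :
    Submodule.span ℂ (Set.range (evenMonomial C D u)) =
      Subalgebra.toSubmodule (Algebra.adjoin ℂ ({C ^ 2 * u, C * D * u, D ^ 2 * u} : Set G)) := by
  have hDC : D * C = q⁻¹ • (C * D) := quasiCommute_symm hq hCD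
  have mem (l m n : ℕ) (k : Bool × ℕ × ℕ) (hl : l = 2 * k.2.1 + k.1.toNat)
      (hm : m = 2 * k.2.2 + k.1.toNat) (hn : n = k.2.1 + k.2.2 + k.1.toNat) :
      D ^ l * C ^ m * u ^ n ∈ Submodule.span ℂ (Set.range (evenMonomial C D u)) := by
    subst hl hm hn
    exact Submodule.subset_span ⟨k, rfl⟩
  apply le_antisymm
  · rw [Submodule.span_le]
    rintro _ ⟨⟨ε, i, j⟩, rfl⟩
    set A := Algebra.adjoin ℂ ({C ^ 2 * u, C * D * u, D ^ 2 * u} : Set G)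
    have hCC : C ^ 2 * u ∈ A := Algebra.subset_adjoin (by simp)
    have hCD' : C * D * u ∈ A := Algebra.subset_adjoin (by simp)
    have hDD : D ^ 2 * u ∈ A := Algebra.subset_adjoin (by simp)
    have hDi : D ^ (2 * i) * u ^ i ∈ A := by
      rw [pow_mul, ← (hD.symm.pow_left 2).mul_pow]
      exact pow_mem hDD i
    have hCi : C ^ (2 * j) * u ^ j ∈ A := by
      rw [pow_mul, ← (hC.symm.pow_left 2).mul_pow]
      exact pow_mem hCC j
    have hmul := monomial_mul_monomial hCD hC hD (2 * i) 0 i 0 (2 * j) j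
    simp only [pow_zero, mul_one, one_mul, one_smul, add_zero, zero_add] at hmul
    cases ε with
    | false =>
      simp only [evenMonomial, Bool.toNat_false, add_zero]
      rw [← hmul]
      change _ ∈ A
      exact mul_mem hDi hCi
    | true =>
      have h1 := monomial_mul_monomial hCD hC hD (2 * i) 0 i 1 1 1
      have h2 := monomial_mul_monomial hCD hC hD (2 * i + 1) 1 (i + 1) 0 (2 * j) j
      simp only [pow_zero, mul_one, one_mul, one_smul, pow_one, zero_add,
        add_zero] at h1 h2
      simp only [evenMonomial, Bool.toNat_true]
      rw [add_comm (2 * j), add_right_comm i j 1, ← h2, ← h1]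
      change _ ∈ A
      refine mul_mem (mul_mem hDi ?_) hCi
      rw [hDC, smul_mul_assoc]
      exact Subalgebra.smul_mem _ hCD' _
  · apply adjoin_le_of_mul_mem
    · simpa using mem 0 0 0 (false, 0, 0)
    · intro y hy s hs
      have hs' : ∃ l' m' : ℕ, ((l' = 0 ∧ m' = 2) ∨ (l' = 1 ∧ m' = 1) ∨ (l' = 2 ∧ m' = 0)) ∧
          ∃ r : ℂ, s = r • (D ^ l' * C ^ m' * u ^ 1) := by
        rcases hs with rfl | rfl | rfl
        · exact ⟨0, 2, by simp, 1, by simp⟩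
        · exact ⟨1, 1, by simp, q, by simp [hCD]⟩
        · exact ⟨2, 0, by simp, 1, by simp⟩
      obtain ⟨l', m', hlm, r, rfl⟩ := hs'
      rw [mul_smul_comm]
      apply Submodule.smul_mem
      induction hy using Submodule.span_induction with
      | zero => simp
      | add y z _ _ hy hz => rw [add_mul]; exact add_mem hy hz
      | smul t y _ hy => rw [smul_mul_assoc]; exact Submodule.smul_mem _ _ hy
      | mem y hy =>
        obtain ⟨⟨ε, i, j⟩, rfl⟩ := hy
        rw [evenMonomial, monomial_mul_monomial hCD hC hD]
        apply Submodule.smul_mem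
        rcases hlm with ⟨rfl, rfl⟩ | ⟨rfl, rfl⟩ | ⟨rfl, rfl⟩
        · refine mem _ _ _ (ε, i, j + 1) ?_ ?_ ?_ <;> dsimp only <;> omega
        · cases ε with
          | false => refine mem _ _ _ (true, i, j) ?_ ?_ ?_ <;> simp
          | true => refine mem _ _ _ (false, i + 1, j + 1) ?_ ?_ ?_ <;> simp <;> omega
        · refine mem _ _ _ (ε, i + 1, j) ?_ ?_ ?_ <;> dsimp only <;> omega

end EvenMonomials

section CoorbitMaps

variable {R G : Type*} [Ring R] [Algebra ℂ R] [Ring G] [Algebra ℂ G]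

/-- The monomials `a ^ ε * b ^ i * c ^ j` with `ε ≤ 1`. -/
def coorbitMonomial (a b c : R) (k : Bool × ℕ × ℕ) : R :=
  a ^ k.1.toNat * b ^ k.2.1 * c ^ k.2.2

/-- Right multiples of a weighted trace and of the quantum determinant. -/
def traceDetMultiples (q r s : ℂ) (a b c d : R) : Set R :=
  {y | ∃ h, y = (s • a + r • d) * h ∨ y = (a * d - q • (b * c)) * h}

variable {q : ℂ} {a b c d : R}

theorem mul_mem_span_traceDetMultiples {r s : ℂ} {y : R}
    (hy : y ∈ Submodule.span ℂ (traceDetMultiples q r s a b c d)) (x : R) :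
    y * x ∈ Submodule.span ℂ (traceDetMultiples q r s a b c d) := by
  induction hy using Submodule.span_induction with
  | zero => simp
  | add y z _ _ hy hz => rw [add_mul]; exact add_mem hy hz
  | smul t y _ hy => rw [smul_mul_assoc]; exact Submodule.smul_mem _ _ hy
  | mem y hy =>
    obtain ⟨h, rfl | rfl⟩ := hy
    · exact Submodule.subset_span ⟨h * x, Or.inl (mul_assoc _ _ _)⟩
    · exact Submodule.subset_span ⟨h * x, Or.inr (mul_assoc _ _ _)⟩

theorem span_coorbitMonomial_sup (hq : q ≠ 0) (hab : a * b = q • (b * a))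
    (hac : a * c = q • (c * a)) (hbc : b * c = c * b) (hbd : b * d = q • (d * b))
    (hcd : c * d = q • (d * c)) (had : a * d - d * a = (q - q⁻¹) • (b * c))
    (hgen : Algebra.adjoin ℂ ({a, b, c, d} : Set R) = ⊤) {r s : ℂ} (hr : r ≠ 0) (hs : s ≠ 0) :
    Submodule.span ℂ (Set.range (coorbitMonomial a b c)) ⊔
      Submodule.span ℂ (traceDetMultiples q r s a b c d) = ⊤ := by
  set V := Submodule.span ℂ (Set.range (coorbitMonomial a b c))
  set I := Submodule.span ℂ (traceDetMultiples q r s a b c d)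
  have monomial_mem (ε : Bool) (i j : ℕ) : a ^ ε.toNat * b ^ i * c ^ j ∈ V ⊔ I :=
    le_sup_left (a := V) (Submodule.subset_span ⟨(ε, i, j), rfl⟩)
  have mem_of_sub {x y : R} (hx : x ∈ V ⊔ I) (hxy : y - x ∈ I) : y ∈ V ⊔ I := by
    rw [← sub_add_cancel y x]
    exact add_mem (le_sup_right (a := V) hxy) hx
  have htr (h : R) : (s • a + r • d) * h ∈ I := Submodule.subset_span ⟨h, Or.inl rfl⟩
  have hdet (h : R) : (a * d - q • (b * c)) * h ∈ I := Submodule.subset_span ⟨h, Or.inr rfl⟩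
  have hbcj (i j : ℕ) : b ^ i * c ^ j * b = b ^ (i + 1) * c ^ j := by
    rw [mul_assoc, ((show Commute b c from hbc).symm.pow_left j).eq, ← mul_assoc, pow_succ]
  have hbca (i j : ℕ) : b ^ i * c ^ j * a = ((q⁻¹) ^ j * (q⁻¹) ^ i) • (a * (b ^ i * c ^ j)) := by
    rw [mul_assoc, pow_mul_of_quasiCommute (quasiCommute_symm hq hac), mul_smul_comm, ← mul_assoc,
      pow_mul_of_quasiCommute (quasiCommute_symm hq hab), smul_mul_assoc, smul_smul, mul_assoc]
  have hbcd (i j : ℕ) : b ^ i * c ^ j * d = (q ^ j * q ^ i) • (d * (b ^ i * c ^ j)) := by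
    rw [mul_assoc, pow_mul_of_quasiCommute hcd, mul_smul_comm, ← mul_assoc,
      pow_mul_of_quasiCommute hbd, smul_mul_assoc, smul_smul, mul_assoc]
  have hbb (i j : ℕ) : b * c * (b ^ i * c ^ j) ∈ V ⊔ I := by
    have h := monomial_mem false (i + 1) (j + 1)
    rw [Bool.toNat_false, pow_zero, one_mul, pow_succ' b, pow_succ' c, mul_assoc,
      ← mul_assoc (b ^ i), ((show Commute b c from hbc).pow_left i).eq] at h
    simpa only [mul_assoc] using h
  have hda : d * a = a * d - (q - q⁻¹) • (b * c) := by rw [← had]; abel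
  have haa (i j : ℕ) : a * a * (b ^ i * c ^ j) ∈ V ⊔ I := by
    refine mem_of_sub (x := (-(s⁻¹ * r * q⁻¹)) • (b * c * (b ^ i * c ^ j)))
      (Submodule.smul_mem _ _ (hbb i j)) ?_
    have h := sub_mem (I.smul_mem s⁻¹ (htr (a * (b ^ i * c ^ j))))
      (I.smul_mem (s⁻¹ * r) (hdet (b ^ i * c ^ j)))
    convert h using 1
    have h1 : (s • a + r • d) * (a * (b ^ i * c ^ j)) =
        s • (a * a * (b ^ i * c ^ j)) + r • (d * a * (b ^ i * c ^ j)) := by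
      simp only [add_mul, smul_mul_assoc, mul_assoc]
    rw [h1, hda]
    simp only [sub_mul, smul_mul_assoc]
    match_scalars <;> field_simp <;> ring
  have had' (i j : ℕ) : a * d * (b ^ i * c ^ j) ∈ V ⊔ I := by
    refine mem_of_sub (x := q • (b * c * (b ^ i * c ^ j)))
      (Submodule.smul_mem _ _ (hbb i j)) ?_
    simpa only [sub_mul, smul_mul_assoc] using hdet (b ^ i * c ^ j)
  have hd' (i j : ℕ) : d * (b ^ i * c ^ j) ∈ V ⊔ I := by
    refine mem_of_sub (x := (-(r⁻¹ * s)) • (a * (b ^ i * c ^ j)))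
      (Submodule.smul_mem _ _ ?_) ?_
    · simpa [mul_assoc] using monomial_mem true i j
    · convert I.smul_mem r⁻¹ (htr (b ^ i * c ^ j)) using 1
      simp only [add_mul, smul_mul_assoc]
      match_scalars <;> field_simp
  rw [eq_top_iff, ← Algebra.top_toSubmodule, ← hgen]
  apply adjoin_le_of_mul_mem
  · simpa using monomial_mem false 0 0
  · intro y hy x hx
    obtain ⟨v, hv, w, hw, rfl⟩ := Submodule.mem_sup.mp hy
    rw [add_mul]
    refine add_mem ?_ (le_sup_right (a := V) (mul_mem_span_traceDetMultiples hw x))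
    clear hy
    induction hv using Submodule.span_induction with
    | zero => simp
    | add y z _ _ hy hz => rw [add_mul]; exact add_mem hy hz
    | smul t y _ hy => rw [smul_mul_assoc]; exact Submodule.smul_mem _ _ hy
    | mem y hy =>
      obtain ⟨⟨ε, i, j⟩, rfl⟩ := hy
      simp only [coorbitMonomial]
      rcases hx with rfl | rfl | rfl | rfl
      · rw [mul_assoc (x ^ _), mul_assoc, hbca, mul_smul_comm]
        apply Submodule.smul_mem
        cases ε with
        | false => simpa [mul_assoc] using monomial_mem true i j
        | true => simpa [mul_assoc] using haa i j
      · rw [mul_assoc (a ^ _), mul_assoc, hbcj]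
        simpa [mul_assoc] using monomial_mem ε (i + 1) j
      · rw [mul_assoc, ← pow_succ]
        exact monomial_mem ε i (j + 1)
      · rw [mul_assoc (a ^ _), mul_assoc, hbcd, mul_smul_comm]
        apply Submodule.smul_mem
        cases ε with
        | false => simpa using hd' i j
        | true => simpa [mul_assoc] using had' i j

variable {C D u : G} {f : R →ₗ[ℂ] G} {κa κb κc κd : ℂ}

theorem map_coorbitMonomial (hq : q ≠ 0) (hCD : C * D = q • (D * C)) (hC : Commute u C)
    (hD : Commute u D) (f1 : f 1 = 1) (hκa : κa ≠ 0) (hκb : κb ≠ 0) (hκc : κc ≠ 0)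
    (fa : ∀ h, f (h * a) = κa • (D * f h * (C * u)))
    (fb : ∀ h, f (h * b) = κb • (D * f h * (D * u)))
    (fc : ∀ h, f (h * c) = κc • (C * f h * (C * u))) (k : Bool × ℕ × ℕ) :
    ∃ t : ℂ, t ≠ 0 ∧ f (coorbitMonomial a b c k) = t • evenMonomial C D u k := by
  have stepb {h : R} {l m n : ℕ} (hh : ∃ t : ℂ, t ≠ 0 ∧ f h = t • (D ^ l * C ^ m * u ^ n)) :
      ∃ t : ℂ, t ≠ 0 ∧ f (h * b) = t • (D ^ (l + 2) * C ^ m * u ^ (n + 1)) := by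
    obtain ⟨t, ht, hh⟩ := hh
    have h1 := monomial_mul_monomial hCD hC hD l m n 1 0 1
    simp only [pow_one, pow_zero, mul_one, add_zero] at h1
    refine ⟨κb * (t * q ^ m), by positivity, ?_⟩
    rw [fb, hh, mul_assoc, smul_mul_assoc, h1, mul_smul_comm, mul_smul_comm, smul_smul, smul_smul,
      ← mul_assoc, ← mul_assoc, ← pow_succ', mul_assoc κb]
  have stepc {h : R} {l m n : ℕ} (hh : ∃ t : ℂ, t ≠ 0 ∧ f h = t • (D ^ l * C ^ m * u ^ n)) :
      ∃ t : ℂ, t ≠ 0 ∧ f (h * c) = t • (D ^ l * C ^ (m + 2) * u ^ (n + 1)) := by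
    obtain ⟨t, ht, hh⟩ := hh
    have h1 := monomial_mul_monomial hCD hC hD l m n 0 1 1
    simp only [pow_one, pow_zero, one_mul, add_zero, one_pow, one_smul] at h1
    refine ⟨κc * (t * q ^ l), by positivity, ?_⟩
    rw [fc, hh, mul_assoc, smul_mul_assoc, h1, mul_smul_comm, ← mul_assoc, ← mul_assoc,
      mul_pow_of_quasiCommute hCD, smul_mul_assoc, smul_mul_assoc, smul_smul, smul_smul,
      mul_assoc (D ^ l), ← pow_succ', mul_assoc κc]
  obtain ⟨ε, i, j⟩ := k
  simp only [coorbitMonomial, evenMonomial]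
  induction j with
  | succ j ih =>
    obtain ⟨t, ht, h⟩ := stepc ih
    refine ⟨t, ht, ?_⟩
    rw [pow_succ c, ← mul_assoc, h, show 2 * (j + 1) + ε.toNat = 2 * j + ε.toNat + 2 by ring,
      show i + (j + 1) + ε.toNat = i + j + ε.toNat + 1 by ring]
  | zero =>
    simp only [pow_zero, mul_one]
    induction i with
    | succ i ih =>
      obtain ⟨t, ht, h⟩ := stepb ih
      refine ⟨t, ht, ?_⟩
      rw [pow_succ b, ← mul_assoc, h, show 2 * (i + 1) + ε.toNat = 2 * i + ε.toNat + 2 by ring,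
        show i + 1 + 0 + ε.toNat = i + 0 + ε.toNat + 1 by ring]
    | zero =>
      cases ε with
      | false => exact ⟨1, one_ne_zero, by simp [f1]⟩
      | true =>
        refine ⟨κa, hκa, ?_⟩
        have := fa 1
        simpa [f1, mul_assoc] using this

theorem range_and_ker_of_quasiCommute (hq : q ≠ 0) (hab : a * b = q • (b * a))
    (hac : a * c = q • (c * a)) (hbc : b * c = c * b) (hbd : b * d = q • (d * b))
    (hcd : c * d = q • (d * c)) (had : a * d - d * a = (q - q⁻¹) • (b * c))
    (hgen : Algebra.adjoin ℂ ({a, b, c, d} : Set R) = ⊤) {r s : ℂ} (hr : r ≠ 0) (hs : s ≠ 0)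
    (hCD : C * D = q • (D * C)) (hC : Commute u C)
    (hD : Commute u D) (hli : LinearIndependent ℂ (evenMonomial C D u))
    (f1 : f 1 = 1) (hκa : κa ≠ 0) (hκb : κb ≠ 0) (hκc : κc ≠ 0)
    (hκ : κa * κd = κb * κc) (hrs : s * κa = -(r * κd * q))
    (fa : ∀ h, f (h * a) = κa • (D * f h * (C * u)))
    (fb : ∀ h, f (h * b) = κb • (D * f h * (D * u)))
    (fc : ∀ h, f (h * c) = κc • (C * f h * (C * u)))
    (fd : ∀ h, f (h * d) = κd • (C * f h * (D * u))) :
    LinearMap.range f =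
        Subalgebra.toSubmodule (Algebra.adjoin ℂ ({C ^ 2 * u, C * D * u, D ^ 2 * u} : Set G)) ∧
      LinearMap.ker f = Submodule.span ℂ (traceDetMultiples q r s a b c d) := by
  set V := Submodule.span ℂ (Set.range (coorbitMonomial a b c)) with hV
  set I := Submodule.span ℂ (traceDetMultiples q r s a b c d)
  have hsup : V ⊔ I = ⊤ := span_coorbitMonomial_sup hq hab hac hbc hbd hcd had hgen hr hs
  choose t ht hft using map_coorbitMonomial hq hCD hC hD f1 hκa hκb hκc fa fb fc
  have ker_mul {y : R} (hy : f y = 0) (z : R) : f (y * z) = 0 := by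
    have h : z ∈ Algebra.adjoin ℂ ({a, b, c, d} : Set R) := hgen ▸ Algebra.mem_top
    induction h using Algebra.adjoin_induction generalizing y with
    | mem x hx => rcases hx with rfl | rfl | rfl | rfl <;> simp [fa, fb, fc, fd, hy]
    | algebraMap r => rw [← Algebra.commutes, ← Algebra.smul_def, map_smul, hy, smul_zero]
    | add u v _ _ hu hv => rw [mul_add, map_add, hu hy, hv hy, add_zero]
    | mul u v _ _ hu hv => rw [← mul_assoc]; exact hv (hu hy)
  have ga : f a = κa • (D * (C * u)) := by simpa [f1] using fa 1
  have gb : f b = κb • (D * (D * u)) := by simpa [f1] using fb 1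
  have gd : f d = κd • (C * (D * u)) := by simpa [f1] using fd 1
  have hker : I ≤ LinearMap.ker f := by
    rw [Submodule.span_le]
    rintro _ ⟨h, rfl | rfl⟩ <;> refine ker_mul ?_ h
    · rw [map_add, map_smul, map_smul, ga, gd, ← mul_assoc C, hCD, smul_mul_assoc, mul_assoc]
      match_scalars
      linear_combination hrs
    · have h1 := monomial_mul_monomial hCD hC hD 1 2 1 1 0 1
      have h2 := monomial_mul_monomial hCD hC hD 2 1 1 0 1 1
      simp only [pow_one, pow_zero, mul_one, one_mul, one_smul] at h1 h2
      have h3 : C * (D * (C * u)) * (D * u) = q ^ 3 • (D ^ 2 * C ^ 2 * u ^ 2) := by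
        rw [← mul_assoc C, hCD, smul_mul_assoc, mul_assoc D, ← mul_assoc C, ← pow_two,
          ← mul_assoc D, smul_mul_assoc, h1, smul_smul, ← pow_succ']
      have h4 : C * (D * (D * u)) * (C * u) = q ^ 2 • (D ^ 2 * C ^ 2 * u ^ 2) := by
        rw [← mul_assoc D, ← pow_two, ← mul_assoc C, mul_pow_of_quasiCommute hCD, smul_mul_assoc,
          smul_mul_assoc, h2]
      rw [map_sub, map_smul, fd, fc, ga, gb, mul_smul_comm, mul_smul_comm, smul_mul_assoc,
        smul_mul_assoc, h3, h4]
      match_scalars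
      linear_combination q ^ 3 * hκ
  have hli' : LinearIndependent ℂ (f ∘ coorbitMonomial a b c) := by
    convert hli.units_smul (fun k => Units.mk0 (t k) (ht k)) using 1
    ext k
    simp [hft, Units.smul_def]
  constructor
  · rw [← span_evenMonomial hq hCD hC hD, LinearMap.range_eq_map, ← hsup, Submodule.map_sup,
      LinearMap.le_ker_iff_map.mp hker, sup_bot_eq, hV, Submodule.map_span]
    apply le_antisymm
    · rw [Submodule.span_le]
      rintro _ ⟨_, ⟨k, rfl⟩, rfl⟩
      rw [hft]
      exact Submodule.smul_mem _ _ (Submodule.subset_span ⟨k, rfl⟩)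
    · rw [Submodule.span_le]
      rintro _ ⟨k, rfl⟩
      rw [← inv_smul_smul₀ (ht k) (evenMonomial C D u k), ← hft]
      exact Submodule.smul_mem _ _ (Submodule.subset_span ⟨_, ⟨k, rfl⟩, rfl⟩)
  · refine le_antisymm (fun y hy => ?_) hker
    obtain ⟨v, hv, w, hw, rfl⟩ := Submodule.mem_sup.mp (hsup ▸ Submodule.mem_top : y ∈ V ⊔ I)
    have hv0 : v ∈ LinearMap.ker f := by
      simpa using sub_mem hy (hker hw)
    rw [Submodule.disjoint_def.mp (Submodule.range_ker_disjoint hli') v hv hv0, zero_add]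
    exact hw

end CoorbitMaps

theorem qdet_fin_two {M : Type} [Ring M] [Algebra ℂ M] (q : ℂ) (x : Fin 2 → Fin 2 → M) :
    qdet q x = x 0 0 * x 1 1 - q • (x 0 1 * x 1 0) := by
  have hcard : (Finset.univ : Finset (Fin 2)).card = 2 := rfl
  have hord (k : Fin 2) : (Finset.univ.orderIsoOfFin hcard k).1 = k := by
    rw [Finset.coe_orderIsoOfFin_apply]
    exact (congrFun (Finset.orderEmbOfFin_unique hcard (f := id) (by simp) strictMono_id) k).symm
  change ∑ σ : Equiv.Perm (Fin 2), ((-q) ^ invCount σ) •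
    ((List.finRange 2).map fun k =>
      x (Finset.univ.orderIsoOfFin hcard k).1 (Finset.univ.orderIsoOfFin hcard (σ k)).1).prod = _
  have huniv : (Finset.univ : Finset (Equiv.Perm (Fin 2))) = {1, Equiv.swap 0 1} := by decide
  have h1 : invCount (1 : Equiv.Perm (Fin 2)) = 0 := by decide
  have h2 : invCount (Equiv.swap 0 1 : Equiv.Perm (Fin 2)) = 1 := by decide
  have h3 : List.finRange 2 = [0, 1] := by decide
  simp only [hord]
  rw [huniv, Finset.sum_pair (by decide), h1, h2, h3]
  simp [sub_eq_add_neg]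

section LinearIndependence

/-- The shift of the second coordinate on functions on `ℤ × ℕ`. -/
def shiftRight : Module.End ℂ (ℤ × ℕ →₀ ℂ) :=
  Finsupp.linearCombination ℂ fun p => Finsupp.single (p.1, p.2 + 1) 1

/-- The `n`-fold twisted shift of the first coordinate on functions on `ℤ × ℕ`. -/
def twistedShift (q : ℂ) (n : ℤ) : Module.End ℂ (ℤ × ℕ →₀ ℂ) :=
  Finsupp.linearCombination ℂ fun p => Finsupp.single (p.1 + n, p.2) ((q ^ p.2) ^ (-n))

theorem shiftRight_mul_twistedShift {q : ℂ} (hq : q ≠ 0) (n : ℤ) :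
    shiftRight * twistedShift q n = q ^ n • (twistedShift q n * shiftRight) := by
  refine Finsupp.lhom_ext fun p t => ?_
  simp only [shiftRight, twistedShift, Module.End.mul_apply, LinearMap.smul_apply,
    Finsupp.linearCombination_single, Finsupp.smul_single, smul_eq_mul, mul_one]
  congr 1
  rw [pow_succ, mul_zpow, zpow_neg q]
  field_simp

theorem twistedShift_mul {q : ℂ} (hq : q ≠ 0) (m n : ℤ) :
    twistedShift q m * twistedShift q n = twistedShift q (m + n) := by
  refine Finsupp.lhom_ext fun p t => ?_
  simp only [twistedShift, Module.End.mul_apply, Finsupp.linearCombination_single,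
    Finsupp.smul_single, smul_eq_mul]
  rw [show p.1 + n + m = p.1 + (m + n) by ring, neg_add, zpow_add₀ (pow_ne_zero _ hq)]
  congr 1
  ring

theorem twistedShift_zero (q : ℂ) : twistedShift q 0 = 1 := by
  ext p r
  simp [twistedShift]

theorem shiftRight_pow_single (m : ℕ) :
    (shiftRight ^ m) (Finsupp.single ((0 : ℤ), (0 : ℕ)) 1) = Finsupp.single (0, m) 1 := by
  induction m with
  | zero => simp
  | succ m ih => rw [pow_succ', Module.End.mul_apply, ih]; simp [shiftRight]

theorem twistedShift_pow {q : ℂ} (hq : q ≠ 0) (n : ℕ) : twistedShift q 1 ^ n = twistedShift q n := by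
  induction n with
  | zero => simp [twistedShift_zero]
  | succ n ih => rw [pow_succ, ih, twistedShift_mul hq, Nat.cast_succ]

theorem linearIndependent_evenMonomial {q : ℂ} (hq : q ≠ 0) {G : Type*} [Ring G] [Algebra ℂ G]
    {C D u : G} (ψ : G →ₐ[ℂ] Module.End ℂ (ℤ × ℕ →₀ ℂ)) (hC : ψ C = shiftRight)
    (hD : ψ D = twistedShift q 1) (hu : ψ u = 1) :
    LinearIndependent ℂ (evenMonomial C D u) := by
  let L : G →ₗ[ℂ] (ℤ × ℕ →₀ ℂ) :=
    (LinearMap.applyₗ (Finsupp.single ((0 : ℤ), (0 : ℕ)) (1 : ℂ))) ∘ₗ ψ.toLinearMap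
  let φ : Bool × ℕ × ℕ → ℤ × ℕ := fun k =>
    (((2 * k.2.1 + k.1.toNat : ℕ) : ℤ), 2 * k.2.2 + k.1.toNat)
  have hφ : Function.Injective φ := by
    rintro ⟨ε, i, j⟩ ⟨ε', i', j'⟩ h
    simp only [φ, Prod.mk.injEq, Nat.cast_inj] at h
    cases ε <;> cases ε' <;> simp at h ⊢ <;> omega
  apply LinearIndependent.of_comp L
  have hbasis := (Finsupp.basisSingleOne (R := ℂ) (ι := ℤ × ℕ)).linearIndependent.comp φ hφ
  convert hbasis.units_smul (fun k => Units.mk0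
    ((q ^ (φ k).2) ^ (-(φ k).1)) (zpow_ne_zero _ (pow_ne_zero _ hq))) using 1
  ext1 k
  simp only [L, evenMonomial, Function.comp_apply, LinearMap.comp_apply, AlgHom.toLinearMap_apply,
    map_mul, map_pow, hC, hD, hu, one_pow, mul_one, LinearMap.applyₗ_apply_apply,
    Module.End.mul_apply, shiftRight_pow_single, twistedShift_pow hq]
  simp [twistedShift, φ, Units.smul_def]

end LinearIndependence

section CoorbitFormulas

theorem antipode_mul_of_convolution_inverse {G : Type} [Ring G] [Algebra ℂ G]
    (Δ : G →ₐ[ℂ] G ⊗[ℂ] G) (ε : G →ₐ[ℂ] ℂ)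
    (hcoassoc : (Algebra.TensorProduct.assoc ℂ ℂ ℂ G G G).toAlgHom.comp
      ((Algebra.TensorProduct.map Δ (.id ℂ G)).comp Δ) =
      (Algebra.TensorProduct.map (.id ℂ G) Δ).comp Δ)
    (hr : (Algebra.TensorProduct.map ε (.id ℂ G)).comp Δ =
      (Algebra.TensorProduct.lid ℂ G).symm)
    (hl : (Algebra.TensorProduct.map (.id ℂ G) ε).comp Δ =
      (Algebra.TensorProduct.rid ℂ ℂ G).symm)
    (S : G →ₗ[ℂ] G)
    (hS1 : LinearMap.mul' ℂ G ∘ₗ TensorProduct.map S LinearMap.id ∘ₗ Δ.toLinearMap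
      = Algebra.linearMap ℂ G ∘ₗ ε.toLinearMap)
    (hS2 : LinearMap.mul' ℂ G ∘ₗ TensorProduct.map LinearMap.id S ∘ₗ Δ.toLinearMap
      = Algebra.linearMap ℂ G ∘ₗ ε.toLinearMap) (y z : G) :
    S (y * z) = S z * S y := by
  let _ : Bialgebra ℂ G := .ofAlgHom Δ ε hcoassoc hr hl
  let _ : HopfAlgebra ℂ G :=
    { antipode := S
      mul_antipode_rTensor_comul := hS1
      mul_antipode_lTensor_comul := hS2 }
  exact HopfAlgebra.antipode_mul_antidistrib y z

variable {M G : Type} [Ring M] [Algebra ℂ M] [Ring G] [Algebra ℂ G]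
  {ΔM : M →ₐ[ℂ] M ⊗[ℂ] M} {ι : M →ₐ[ℂ] G} {St : G →ₗ[ℂ] G} {e : M →ₐ[ℂ] ℂ}

theorem coorbit_adjBeta_mul (hSt : ∀ y z, St (y * z) = St z * St y) {x : Fin 2 → Fin 2 → M}
    (hΔM : ∀ i j, ΔM (x i j) = ∑ k, x i k ⊗ₜ[ℂ] x k j) {ξ1 : ℂ}
    (he00 : e (x 0 0) = 0) (he01 : e (x 0 1) = ξ1)
    (he10 : e (x 1 0) = 0) (he11 : e (x 1 1) = 0) (h : M) (i j : Fin 2) :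
    coorbit e (adjBeta ΔM ι St) (h * x i j) =
      ξ1 • (St (ι (x i 0)) * coorbit e (adjBeta ΔM ι St) h * ι (x 1 j)) := by
  let Ψ : (M ⊗[ℂ] M) ⊗[ℂ] M →ₗ[ℂ] G :=
    (TensorProduct.lid ℂ G).toLinearMap ∘ₗ TensorProduct.map e.toLinearMap LinearMap.id ∘ₗ
    TensorProduct.map LinearMap.id (LinearMap.mul' ℂ G) ∘ₗ
    (TensorProduct.assoc ℂ M G G).toLinearMap ∘ₗ
    TensorProduct.map
      ((TensorProduct.comm ℂ G M).toLinearMap ∘ₗ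
        TensorProduct.map (St ∘ₗ ι.toLinearMap) LinearMap.id)
      ι.toLinearMap
  let T : M →ₐ[ℂ] (M ⊗[ℂ] M) ⊗[ℂ] M := (Algebra.TensorProduct.map ΔM (.id ℂ M)).comp ΔM
  have hΨT (h : M) : coorbit e (adjBeta ΔM ι St) h = Ψ (T h) := rfl
  have hΨ (p r s : M) : Ψ ((p ⊗ₜ r) ⊗ₜ s) = e r • (St (ι p) * ι s) := by simp [Ψ]
  have hmul (t : (M ⊗[ℂ] M) ⊗[ℂ] M) (p r s : M) :
      Ψ (t * ((p ⊗ₜ r) ⊗ₜ s)) = e r • (St (ι p) * Ψ t * ι s) := by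
    induction t with
    | zero => simp
    | add t t' ht ht' => simp only [add_mul, mul_add, map_add, ht, ht', smul_add]
    | tmul w s' =>
      induction w with
      | zero => simp
      | add w w' hw hw' =>
        simp only [TensorProduct.add_tmul, add_mul, mul_add, map_add, hw, hw', smul_add]
      | tmul p' r' =>
        simp only [Algebra.TensorProduct.tmul_mul_tmul, hΨ, map_mul, hSt, mul_smul_comm,
          smul_mul_assoc, smul_smul, mul_assoc, mul_comm]
  have hT : T (x i j) = ∑ l, ∑ k, (x i k ⊗ₜ[ℂ] x k l) ⊗ₜ[ℂ] x l j := by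
    simp [T, hΔM, TensorProduct.add_tmul]
  rw [hΨT, hΨT, map_mul, hT]
  simp [Fin.sum_univ_two, mul_add, hmul, he00, he01, he10, he11]

theorem coorbit_adjAlpha_mul (hSt : ∀ y z, St (y * z) = St z * St y) {x : Fin 2 → Fin 2 → M}
    (hΔM : ∀ i j, ΔM (x i j) = ∑ k, x i k ⊗ₜ[ℂ] x k j) {ξ1 : ℂ}
    (he00 : e (x 0 0) = 0) (he01 : e (x 0 1) = ξ1)
    (he10 : e (x 1 0) = 0) (he11 : e (x 1 1) = 0) (h : M) (i j : Fin 2) :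
    coorbit e (adjAlpha ΔM ι St) (x i j * h) =
      ξ1 • (ι (x 1 j) * coorbit e (adjAlpha ΔM ι St) h * St (ι (x i 0))) := by
  let Ψ : (M ⊗[ℂ] M) ⊗[ℂ] M →ₗ[ℂ] G :=
    (TensorProduct.lid ℂ G).toLinearMap ∘ₗ TensorProduct.map e.toLinearMap LinearMap.id ∘ₗ
    TensorProduct.map LinearMap.id (LinearMap.mul' ℂ G) ∘ₗ
    TensorProduct.map LinearMap.id (TensorProduct.comm ℂ G G).toLinearMap ∘ₗ
    (TensorProduct.assoc ℂ M G G).toLinearMap ∘ₗ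
    TensorProduct.map
      ((TensorProduct.comm ℂ G M).toLinearMap ∘ₗ
        TensorProduct.map (St ∘ₗ ι.toLinearMap) LinearMap.id)
      ι.toLinearMap
  let T : M →ₐ[ℂ] (M ⊗[ℂ] M) ⊗[ℂ] M := (Algebra.TensorProduct.map ΔM (.id ℂ M)).comp ΔM
  have hΨT (h : M) : coorbit e (adjAlpha ΔM ι St) h = Ψ (T h) := rfl
  have hΨ (p r s : M) : Ψ ((p ⊗ₜ r) ⊗ₜ s) = e r • (ι s * St (ι p)) := by simp [Ψ]
  have hmul (t : (M ⊗[ℂ] M) ⊗[ℂ] M) (p r s : M) :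
      Ψ (((p ⊗ₜ r) ⊗ₜ s) * t) = e r • (ι s * Ψ t * St (ι p)) := by
    induction t with
    | zero => simp
    | add t t' ht ht' => simp only [add_mul, mul_add, map_add, ht, ht', smul_add]
    | tmul w s' =>
      induction w with
      | zero => simp
      | add w w' hw hw' =>
        simp only [TensorProduct.add_tmul, add_mul, mul_add, map_add, hw, hw', smul_add]
      | tmul p' r' =>
        simp only [Algebra.TensorProduct.tmul_mul_tmul, hΨ, map_mul, hSt, mul_smul_comm,
          smul_mul_assoc, smul_smul, mul_assoc]
  have hT : T (x i j) = ∑ l, ∑ k, (x i k ⊗ₜ[ℂ] x k l) ⊗ₜ[ℂ] x l j := by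
    simp [T, hΔM, TensorProduct.add_tmul]
  rw [hΨT, hΨT, map_mul, hT]
  simp [Fin.sum_univ_two, add_mul, hmul, he00, he01, he10, he11]

end CoorbitFormulas

section QuantumMatrixRelations

variable {R : Type*} [Ring R] [Algebra ℂ R] {q : ℂ} {a b c d : R}

theorem commute_quantumDet (hq : q ≠ 0) (hab : a * b = q • (b * a))
    (hac : a * c = q • (c * a)) (hbc : b * c = c * b) (hbd : b * d = q • (d * b))
    (hcd : c * d = q • (d * c)) (had : a * d - d * a = (q - q⁻¹) • (b * c))
    (hgen : Algebra.adjoin ℂ ({a, b, c, d} : Set R) = ⊤) (y : R) :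
    Commute (a * d - q • (b * c)) y := by
  have hda : d * a = a * d - (q - q⁻¹) • (b * c) := by rw [← had]; abel
  have hba := quasiCommute_symm hq hab
  have hca := quasiCommute_symm hq hac
  have hdb := quasiCommute_symm hq hbd
  have hdc := quasiCommute_symm hq hcd
  have hy : y ∈ Algebra.adjoin ℂ ({a, b, c, d} : Set R) := hgen ▸ Algebra.mem_top
  induction hy using Algebra.adjoin_induction with
  | mem y hy =>
    rcases hy with rfl | rfl | rfl | rfl <;> rw [Commute, SemiconjBy, sub_mul, mul_sub]
    · rw [mul_assoc, hda, smul_mul_assoc, mul_assoc b, hca, mul_smul_comm, ← mul_assoc b, hba]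
      simp only [mul_sub, mul_smul_comm, smul_mul_assoc, mul_assoc]
      match_scalars <;> field_simp <;> ring
    · rw [mul_assoc, hdb, mul_smul_comm, ← mul_assoc, hab, smul_mul_assoc, smul_smul,
        inv_mul_cancel₀ hq, one_smul, mul_assoc, smul_mul_assoc, mul_smul_comm, mul_assoc y c y,
        hbc]
    · rw [mul_assoc, hdc, mul_smul_comm, ← mul_assoc, hac, smul_mul_assoc, smul_smul,
        inv_mul_cancel₀ hq, one_smul, mul_assoc, smul_mul_assoc, mul_smul_comm, hbc, mul_assoc]
      rw [hbc]
    · rw [← mul_assoc y a, hda, mul_smul_comm, ← mul_assoc y b, hdb, smul_mul_assoc,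
        smul_mul_assoc, mul_assoc b y c, hdc]
      simp only [sub_mul, mul_smul_comm, smul_mul_assoc, mul_assoc, hcd]
      match_scalars <;> field_simp <;> ring
  | algebraMap r => exact (Algebra.commutes r _).symm
  | add u v _ _ hu hv => exact hu.add_right hv
  | mul u v _ _ hu hv => exact hu.mul_right hv

theorem comul_quantumDet (hq : q ≠ 0) (hab : a * b = q • (b * a)) (hbc : b * c = c * b)
    (hcd : c * d = q • (d * c)) (had : a * d - d * a = (q - q⁻¹) • (b * c)) :
    (a ⊗ₜ[ℂ] a + b ⊗ₜ[ℂ] c) * (c ⊗ₜ[ℂ] b + d ⊗ₜ[ℂ] d) -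
        q • ((a ⊗ₜ[ℂ] b + b ⊗ₜ[ℂ] d) * (c ⊗ₜ[ℂ] a + d ⊗ₜ[ℂ] c)) =
      (a * d - q • (b * c)) ⊗ₜ[ℂ] (a * d - q • (b * c)) := by
  have hda : d * a = a * d - (q - q⁻¹) • (b * c) := by rw [← had]; abel
  simp only [mul_add, add_mul, Algebra.TensorProduct.tmul_mul_tmul, hab, hcd, hda, ← hbc,
    TensorProduct.tmul_sub, TensorProduct.sub_tmul, TensorProduct.tmul_smul,
    ← TensorProduct.smul_tmul']
  match_scalars <;> field_simp <;> ring

end QuantumMatrixRelations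

section RightCoideal

variable {G : Type} [Ring G] [Algebra ℂ G]

theorem comul_mem_range_of_mem_adjoin {q : ℂ} (hq : q ≠ 0) {a b c d u : G}
    (hcd : c * d = q • (d * c)) {Δ : G →ₐ[ℂ] G ⊗[ℂ] G}
    (hΔc : Δ c = c ⊗ₜ a + d ⊗ₜ c) (hΔd : Δ d = c ⊗ₜ b + d ⊗ₜ d) (hΔu : Δ u = u ⊗ₜ u) {f : G}
    (hf : f ∈ Algebra.adjoin ℂ ({c ^ 2 * u, c * d * u, d ^ 2 * u} : Set G)) :
    Δ f ∈ LinearMap.range (TensorProduct.map (Subalgebra.toSubmodule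
      (Algebra.adjoin ℂ ({c ^ 2 * u, c * d * u, d ^ 2 * u} : Set G))).subtype
      (LinearMap.id : G →ₗ[ℂ] G)) := by
  set A := Algebra.adjoin ℂ ({c ^ 2 * u, c * d * u, d ^ 2 * u} : Set G) with hA
  let K : Subalgebra ℂ (G ⊗[ℂ] G) := (Algebra.TensorProduct.map A.val (.id ℂ G)).range
  have hK {v : G} (hv : v ∈ A) (w : G) : v ⊗ₜ[ℂ] w ∈ K := ⟨⟨v, hv⟩ ⊗ₜ w, by simp⟩
  have hcc : c * c * u ∈ A := Algebra.subset_adjoin (by simp [pow_two])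
  have hcd' : c * d * u ∈ A := Algebra.subset_adjoin (by simp)
  have hdd : d * d * u ∈ A := Algebra.subset_adjoin (by simp [pow_two])
  have hdc : d * c * u ∈ A := by
    rw [quasiCommute_symm hq hcd, smul_mul_assoc]
    exact A.smul_mem hcd' _
  have hle : A ≤ K.comap Δ := by
    rw [hA, Algebra.adjoin_le_iff]
    rintro _ (rfl | rfl | rfl) <;>
    · simp only [pow_two, SetLike.mem_coe, Subalgebra.mem_comap, map_mul, hΔc, hΔd, hΔu, add_mul,
        mul_add, Algebra.TensorProduct.tmul_mul_tmul]
      exact add_mem (add_mem (hK (by assumption) _) (hK (by assumption) _))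
        (add_mem (hK (by assumption) _) (hK (by assumption) _))
  obtain ⟨z, hz⟩ := hle hf
  exact ⟨z, hz⟩

end RightCoideal

theorem ker_eq_span_left_of_op {R G : Type*} [Ring R] [Algebra ℂ R] [AddCommGroup G] [Module ℂ G]
    {q : ℂ} {a b c d : R} {f : R →ₗ[ℂ] G}
    (hker : LinearMap.ker (f ∘ₗ (MulOpposite.opLinearEquiv ℂ (M := R)).symm.toLinearMap) =
      Submodule.span ℂ (traceDetMultiples q 1 1 (MulOpposite.op d) (MulOpposite.op b)
        (MulOpposite.op c) (MulOpposite.op a))) (hbc : b * c = c * b) :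
    LinearMap.ker f = Submodule.span ℂ
      {y : R | ∃ h : R, y = h * (a + d) ∨ y = h * (a * d - q • (b * c))} := by
  set S := {y : R | ∃ h : R, y = h * (a + d) ∨ y = h * (a * d - q • (b * c))}
  have hS (y : R) : MulOpposite.op y ∈ traceDetMultiples q 1 1 (MulOpposite.op d)
      (MulOpposite.op b) (MulOpposite.op c) (MulOpposite.op a) ↔ y ∈ S := by
    simp only [traceDetMultiples, S, Set.mem_ofPred_eq, MulOpposite.exists, one_smul,
      ← MulOpposite.op_mul, ← MulOpposite.op_add, ← MulOpposite.op_smul, ← MulOpposite.op_sub,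
      MulOpposite.op_inj, add_comm d a, hbc]
  have hf (y : R) : y ∈ LinearMap.ker f ↔ MulOpposite.op y ∈ Submodule.span ℂ
      (traceDetMultiples q 1 1 (MulOpposite.op d) (MulOpposite.op b) (MulOpposite.op c)
        (MulOpposite.op a)) := by
    rw [← hker]
    rfl
  apply le_antisymm
  · intro y hy
    have hle : Submodule.span ℂ (traceDetMultiples q 1 1 (MulOpposite.op d) (MulOpposite.op b)
        (MulOpposite.op c) (MulOpposite.op a)) ≤ (Submodule.span ℂ S).comap
          (MulOpposite.opLinearEquiv ℂ (M := R)).symm.toLinearMap := by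
      rw [Submodule.span_le]
      exact fun z hz => Submodule.subset_span ((hS z.unop).mp hz)
    exact hle ((hf y).mp hy)
  · rw [Submodule.span_le]
    exact fun y hy => (hf y).mpr (Submodule.subset_span ((hS y).mpr hy))

section LocalizedQuantumMatrices

variable {M G : Type} [Ring M] [Algebra ℂ M] [Ring G] [Algebra ℂ G] {x : Fin 2 → Fin 2 → M}
  {ι : M →ₐ[ℂ] G} {δ : M} {dInv : G}

theorem algHom_ext_of_adjoin_union {B : Type*} [Ring B] [Algebra ℂ B]
    (hgen : Algebra.adjoin ℂ (Set.range fun p : Fin 2 × Fin 2 => x p.1 p.2) = ⊤)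
    (hd1 : ι δ * dInv = 1) (hd2 : dInv * ι δ = 1)
    (hgenG : Algebra.adjoin ℂ
      (Set.range (fun p : Fin 2 × Fin 2 => ι (x p.1 p.2)) ∪ {dInv}) = ⊤)
    {f g : G →ₐ[ℂ] B} (h : ∀ i j, f (ι (x i j)) = g (ι (x i j))) : f = g := by
  have hι : f.comp ι = g.comp ι := by
    refine AlgHom.ext_of_adjoin_eq_top hgen ?_
    rintro _ ⟨p, rfl⟩
    exact h p.1 p.2
  refine AlgHom.ext_of_adjoin_eq_top hgenG ?_
  rintro _ (⟨p, rfl⟩ | rfl)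
  · exact h p.1 p.2
  · refine left_inv_eq_right_inv (a := f (ι δ)) ?_ ?_
    · rw [← map_mul, hd2, map_one]
    · rw [show f (ι δ) = g (ι δ) from DFunLike.congr_fun hι δ, ← map_mul, hd1, map_one]

theorem commute_of_adjoin_union (hδ : ∀ m, Commute δ m)
    (hd1 : ι δ * dInv = 1) (hd2 : dInv * ι δ = 1)
    (hgenG : Algebra.adjoin ℂ
      (Set.range (fun p : Fin 2 × Fin 2 => ι (x p.1 p.2)) ∪ {dInv}) = ⊤) (y : G) :
    Commute dInv y := by
  have hι (m : M) : Commute dInv (ι m) := by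
    have h : ι δ * ι m = ι m * ι δ := (hδ m).map ι
    calc dInv * ι m = dInv * (ι m * ι δ) * dInv := by rw [mul_assoc, mul_assoc, hd1, mul_one]
      _ = ι m * dInv := by rw [← h, ← mul_assoc, hd2, one_mul]
  have hy : y ∈ Algebra.adjoin ℂ
      (Set.range (fun p : Fin 2 × Fin 2 => ι (x p.1 p.2)) ∪ {dInv}) := hgenG ▸ Algebra.mem_top
  induction hy using Algebra.adjoin_induction with
  | mem y hy =>
    rcases hy with ⟨p, rfl⟩ | rfl
    · exact hι _
    · exact Commute.refl _
  | algebraMap r => exact (Algebra.commutes r _).symm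
  | add u v _ _ hu hv => exact hu.add_right hv
  | mul u v _ _ hu hv => exact hu.mul_right hv

theorem antipode_mul_of_adjoin_union
    (hgen : Algebra.adjoin ℂ (Set.range fun p : Fin 2 × Fin 2 => x p.1 p.2) = ⊤)
    (hd1 : ι δ * dInv = 1) (hd2 : dInv * ι δ = 1)
    (hgenG : Algebra.adjoin ℂ
      (Set.range (fun p : Fin 2 × Fin 2 => ι (x p.1 p.2)) ∪ {dInv}) = ⊤)
    {Δ : G →ₐ[ℂ] G ⊗[ℂ] G} (hΔ : ∀ i j, Δ (ι (x i j)) = ∑ k, ι (x i k) ⊗ₜ[ℂ] ι (x k j))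
    {ε : G →ₐ[ℂ] ℂ} (hε : ∀ i j, ε (ι (x i j)) = if i = j then 1 else 0) {S : G →ₗ[ℂ] G}
    (hS1 : LinearMap.mul' ℂ G ∘ₗ TensorProduct.map S LinearMap.id ∘ₗ Δ.toLinearMap
      = Algebra.linearMap ℂ G ∘ₗ ε.toLinearMap)
    (hS2 : LinearMap.mul' ℂ G ∘ₗ TensorProduct.map LinearMap.id S ∘ₗ Δ.toLinearMap
      = Algebra.linearMap ℂ G ∘ₗ ε.toLinearMap) (y z : G) :
    S (y * z) = S z * S y := by
  refine antipode_mul_of_convolution_inverse Δ ε ?_ ?_ ?_ S hS1 hS2 y z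
  · refine algHom_ext_of_adjoin_union hgen hd1 hd2 hgenG fun i j => ?_
    simp [hΔ, TensorProduct.add_tmul, TensorProduct.tmul_add]
    abel
  · refine algHom_ext_of_adjoin_union hgen hd1 hd2 hgenG fun i j => ?_
    fin_cases i <;> fin_cases j <;> simp [hΔ, hε]
  · refine algHom_ext_of_adjoin_union hgen hd1 hd2 hgenG fun i j => ?_
    fin_cases i <;> fin_cases j <;> simp [hΔ, hε]

theorem antipode_quantumMatrix {q : ℂ} {a b c d u : G} {S : G → G}
    (hcd : c * d = q • (d * c)) (hu : (a * d - q • (b * c)) * u = 1)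
    (h00 : S a * a + S b * c = 1) (h01 : S a * b + S b * d = 0)
    (h10 : S c * a + S d * c = 0) (h11 : S c * b + S d * d = 1) :
    S a = d * u ∧ S c = -q • (c * u) := by
  have ha : S a * (a * d - q • (b * c)) = d := by
    rw [mul_sub, ← mul_assoc, mul_smul_comm, ← mul_assoc, eq_neg_of_add_eq_zero_left h01,
      eq_sub_of_add_eq h00, sub_mul, one_mul, neg_mul, mul_assoc, mul_assoc, hcd, mul_smul_comm,
      smul_neg, sub_neg_eq_add, sub_add_cancel]
  have hc : S c * (a * d - q • (b * c)) = -q • c := by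
    rw [mul_sub, ← mul_assoc, mul_smul_comm, ← mul_assoc, eq_neg_of_add_eq_zero_left h10,
      eq_sub_of_add_eq h11, sub_mul, one_mul, neg_mul, mul_assoc, mul_assoc, hcd, mul_smul_comm]
    module
  constructor
  · rw [← mul_one (S a), ← hu, ← mul_assoc, ha]
  · rw [← mul_one (S c), ← hu, ← mul_assoc, hc, smul_mul_assoc]

theorem linearIndependent_evenMonomial_quantumMatrix {q : ℂ} (hq : q ≠ 0)
    (hfree : ∀ (B : Type) [Ring B] [Algebra ℂ B] (y : Fin 2 → Fin 2 → B),
      (∀ i j l : Fin 2, j < l → y i j * y i l = (q) • (y i l * y i j)) →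
      (∀ i k j : Fin 2, i < k → y i j * y k j = (q) • (y k j * y i j)) →
      (∀ i k j l : Fin 2, i < k → j < l → y i l * y k j = y k j * y i l) →
      (∀ i k j l : Fin 2, i < k → j < l →
        y i j * y k l - y k l * y i j = ((q) - (q⁻¹)) • (y i l * y k j)) →
      ∃! φ : M →ₐ[ℂ] B, ∀ i j, φ (x i j) = y i j)
    (hd2 : dInv * ι (qdet q x) = 1)
    (hfreeG : ∀ (B : Type) [Ring B] [Algebra ℂ B] (φ : M →ₐ[ℂ] B) (u : B),
      φ (qdet q x) * u = 1 → u * φ (qdet q x) = 1 → ∃! ψ : G →ₐ[ℂ] B, ψ.comp ι = φ) :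
    LinearIndependent ℂ (evenMonomial (ι (x 1 0)) (ι (x 1 1)) dInv) := by
  obtain ⟨φ, hφ, -⟩ := hfree (Module.End ℂ (ℤ × ℕ →₀ ℂ))
    ![![twistedShift q (-1), 0], ![shiftRight, twistedShift q 1]]
    (by
      intro i j l h
      fin_cases i <;> fin_cases j <;> fin_cases l <;> simp at h ⊢
      simpa using shiftRight_mul_twistedShift hq 1)
    (by
      intro i k j h
      fin_cases i <;> fin_cases j <;> fin_cases k <;> simp at h ⊢
      rw [shiftRight_mul_twistedShift hq, smul_smul]
      simp [hq])
    (by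
      intro i k j l h h'
      fin_cases i <;> fin_cases k <;> fin_cases j <;> fin_cases l <;> simp at h h' ⊢)
    (by
      intro i k j l h h'
      fin_cases i <;> fin_cases k <;> fin_cases j <;> fin_cases l <;> simp at h h' ⊢
      simp [twistedShift_mul hq])
  have hdet : φ (qdet q x) = 1 := by
    simp [qdet_fin_two, hφ, twistedShift_mul hq, twistedShift_zero]
  obtain ⟨ψ, hψ, -⟩ := hfreeG (Module.End ℂ (ℤ × ℕ →₀ ℂ)) φ 1 (by simp [hdet]) (by simp [hdet])
  have hψι (m : M) : ψ (ι m) = φ m := DFunLike.congr_fun hψ m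
  refine linearIndependent_evenMonomial hq ψ (by simp [hψι, hφ]) (by simp [hψι, hφ]) ?_
  simpa [hψι, hdet] using congrArg ψ hd2

end LocalizedQuantumMatrices

theorem adjoin_op_eq_top {R : Type*} [Ring R] [Algebra ℂ R] {a b c d : R}
    (h : Algebra.adjoin ℂ ({a, b, c, d} : Set R) = ⊤) :
    Algebra.adjoin ℂ ({MulOpposite.op d, MulOpposite.op b, MulOpposite.op c,
      MulOpposite.op a} : Set Rᵐᵒᵖ) = ⊤ := by
  rw [← Subalgebra.op_top, ← h, Subalgebra.op_adjoin]
  congr 1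
  ext y
  simp only [Set.mem_insert_iff, Set.mem_singleton_iff, Set.mem_preimage, ← MulOpposite.unop_inj,
    MulOpposite.unop_op]
  tauto

theorem range_eq_of_op {R G : Type*} [Ring R] [Algebra ℂ R] [AddCommGroup G] [Module ℂ G]
    (f : R →ₗ[ℂ] G) :
    LinearMap.range (f ∘ₗ (MulOpposite.opLinearEquiv ℂ (M := R)).symm.toLinearMap) =
      LinearMap.range f :=
  LinearMap.range_comp_of_range_eq_top _ (LinearEquiv.range _)

/-- `N = 2`, `ξ` strictly upper triangular with `ξ₁₂ = ξ₁ ≠ 0`: images and kernels of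
the co-orbit maps `β^ξ` and `α^ξ`. -/
theorem coorbit_2x2_nilpotent
    (q : ℂ) (hq : q ≠ 0)
    (M G : Type) [Ring M] [Algebra ℂ M] [Ring G] [Algebra ℂ G]
    (x : Fin 2 → Fin 2 → M)
    (hrow : ∀ i j l : Fin 2, j < l → x i j * x i l = (q) • (x i l * x i j))
    (hcol : ∀ i k j : Fin 2, i < k → x i j * x k j = (q) • (x k j * x i j))
    (hanti : ∀ i k j l : Fin 2, i < k → j < l → x i l * x k j = x k j * x i l)
    (hdiag : ∀ i k j l : Fin 2, i < k → j < l →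
      x i j * x k l - x k l * x i j = ((q) - (q⁻¹)) • (x i l * x k j))
    (hgen : Algebra.adjoin ℂ (Set.range fun p : Fin 2 × Fin 2 => x p.1 p.2) = ⊤)
    (hfree : ∀ (B : Type) [Ring B] [Algebra ℂ B] (y : Fin 2 → Fin 2 → B),
      (∀ i j l : Fin 2, j < l → y i j * y i l = (q) • (y i l * y i j)) →
      (∀ i k j : Fin 2, i < k → y i j * y k j = (q) • (y k j * y i j)) →
      (∀ i k j l : Fin 2, i < k → j < l → y i l * y k j = y k j * y i l) →
      (∀ i k j l : Fin 2, i < k → j < l →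
        y i j * y k l - y k l * y i j = ((q) - (q⁻¹)) • (y i l * y k j)) →
      ∃! φ : M →ₐ[ℂ] B, ∀ i j, φ (x i j) = y i j)
    (ι : M →ₐ[ℂ] G) (dInv : G)
    (hd1 : ι (qdet (q) x) * dInv = 1)
    (hd2 : dInv * ι (qdet (q) x) = 1)
    (hgenG : Algebra.adjoin ℂ
      (Set.range (fun p : Fin 2 × Fin 2 => ι (x p.1 p.2)) ∪ {dInv}) = ⊤)
    (hfreeG : ∀ (B : Type) [Ring B] [Algebra ℂ B] (φ : M →ₐ[ℂ] B) (u : B),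
      φ (qdet (q) x) * u = 1 → u * φ (qdet (q) x) = 1 →
      ∃! ψ : G →ₐ[ℂ] B, ψ.comp ι = φ)
    (ΔM : M →ₐ[ℂ] M ⊗[ℂ] M)
    (hΔM : ∀ i j, ΔM (x i j) = ∑ k, x i k ⊗ₜ[ℂ] x k j)
    (ΔG : G →ₐ[ℂ] G ⊗[ℂ] G)
    (hΔG : ∀ m, ΔG (ι m) = Algebra.TensorProduct.map ι ι (ΔM m))
    (εG : G →ₐ[ℂ] ℂ)
    (hεG : ∀ i j, εG (ι (x i j)) = if i = j then 1 else 0)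
    (St : G →ₗ[ℂ] G)
    (hS1 : LinearMap.mul' ℂ G ∘ₗ TensorProduct.map St LinearMap.id ∘ₗ ΔG.toLinearMap
      = Algebra.linearMap ℂ G ∘ₗ εG.toLinearMap)
    (hS2 : LinearMap.mul' ℂ G ∘ₗ TensorProduct.map LinearMap.id St ∘ₗ ΔG.toLinearMap
      = Algebra.linearMap ℂ G ∘ₗ εG.toLinearMap)
    (ξ1 : ℂ) (hξ1 : ξ1 ≠ 0) (e : M →ₐ[ℂ] ℂ)
    (he00 : e (x 0 0) = 0) (he01 : e (x 0 1) = ξ1)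
    (he10 : e (x 1 0) = 0) (he11 : e (x 1 1) = 0) :
    Set.range ⇑(coorbit e (adjBeta ΔM ι St)) = ↑(Algebra.adjoin ℂ
      ({ι (x 1 0) ^ 2 * dInv, ι (x 1 0) * ι (x 1 1) * dInv, ι (x 1 1) ^ 2 * dInv} : Set G))
    ∧ (∀ f ∈ (Algebra.adjoin ℂ
      ({ι (x 1 0) ^ 2 * dInv, ι (x 1 0) * ι (x 1 1) * dInv, ι (x 1 1) ^ 2 * dInv} : Set G)), ΔG f ∈ LinearMap.range
        (TensorProduct.map (Subalgebra.toSubmodule (Algebra.adjoin ℂ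
      ({ι (x 1 0) ^ 2 * dInv, ι (x 1 0) * ι (x 1 1) * dInv, ι (x 1 1) ^ 2 * dInv} : Set G))).subtype
          (LinearMap.id : G →ₗ[ℂ] G)))
    ∧ LinearMap.ker (coorbit e (adjBeta ΔM ι St))
        = Submodule.span ℂ {y : M | ∃ h : M, y = ((q ^ 2)⁻¹ • x 0 0 + (q ^ 4)⁻¹ • x 1 1) * h ∨ y = (x 0 0 * x 1 1 - q • (x 0 1 * x 1 0)) * h}
    ∧ Set.range ⇑(coorbit e (adjAlpha ΔM ι St)) = ↑(Algebra.adjoin ℂ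
      ({ι (x 1 0) ^ 2 * dInv, ι (x 1 0) * ι (x 1 1) * dInv, ι (x 1 1) ^ 2 * dInv} : Set G))
    ∧ LinearMap.ker (coorbit e (adjAlpha ΔM ι St))
        = Submodule.span ℂ {y : M | ∃ h : M, y = h * (x 0 0 + x 1 1) ∨ y = h * (x 0 0 * x 1 1 - q • (x 0 1 * x 1 0))} := by
  have hab := hrow 0 0 1 (by decide)
  have hac := hcol 0 1 0 (by decide)
  have hbc := hanti 0 1 0 1 (by decide) (by decide)
  have hbd := hcol 0 1 1 (by decide)
  have hcd := hrow 1 0 1 (by decide)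
  have had := hdiag 0 1 0 1 (by decide) (by decide)
  have hset : (Set.range fun p : Fin 2 × Fin 2 => x p.1 p.2) =
      {x 0 0, x 0 1, x 1 0, x 1 1} := by
    ext y
    simp [Fin.exists_fin_two, or_assoc, eq_comm]
  have hgen' : Algebra.adjoin ℂ {x 0 0, x 0 1, x 1 0, x 1 1} = ⊤ := hset ▸ hgen
  have hli := linearIndependent_evenMonomial_quantumMatrix hq hfree hd2 hfreeG
  have hδ (m : M) : Commute (qdet q x) m := by
    rw [qdet_fin_two]
    exact commute_quantumDet hq hab hac hbc hbd hcd had hgen' m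
  have hu := commute_of_adjoin_union hδ hd1 hd2 hgenG
  have hΔ (i j : Fin 2) : ΔG (ι (x i j)) = ∑ k, ι (x i k) ⊗ₜ[ℂ] ι (x k j) := by
    simp [hΔG, hΔM]
  have hSt := antipode_mul_of_adjoin_union hgen hd1 hd2 hgenG hΔ hεG hS1 hS2
  have hS (i j : Fin 2) : St (ι (x i 0)) * ι (x 0 j) + St (ι (x i 1)) * ι (x 1 j) =
      if i = j then 1 else 0 := by
    have h := LinearMap.congr_fun hS1 (ι (x i j))
    simpa [hΔ, hεG, apply_ite (algebraMap ℂ G)] using h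
  have hSt1 : St 1 = 1 := by simpa [Algebra.TensorProduct.one_def] using LinearMap.congr_fun hS1 1
  have hCD : ι (x 1 0) * ι (x 1 1) = q • (ι (x 1 1) * ι (x 1 0)) := by
    rw [← map_mul, hcd, map_smul, map_mul]
  have hdet : ι (qdet q x) =
      ι (x 0 0) * ι (x 1 1) - q • (ι (x 0 1) * ι (x 1 0)) := by
    simp [qdet_fin_two]
  obtain ⟨hSa, hSc⟩ := antipode_quantumMatrix (S := St) hCD (hdet ▸ hd1) (by simpa using hS 0 0)
    (by simpa using hS 0 1) (by simpa using hS 1 0) (by simpa using hS 1 1)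
  have hΔu : ΔG dInv = dInv ⊗ₜ dInv := by
    have hΔδ : ΔG (ι (qdet q x)) = ι (qdet q x) ⊗ₜ ι (qdet q x) := by
      rw [hΔG, ← Algebra.TensorProduct.map_tmul]
      congr 1
      rw [qdet_fin_two, ← comul_quantumDet hq hab hbc hcd had]
      simp [hΔM]
    refine left_inv_eq_right_inv (a := ΔG (ι (qdet q x))) ?_ ?_
    · rw [← map_mul, hd2, map_one]
    · rw [hΔδ, Algebra.TensorProduct.tmul_mul_tmul, hd1, Algebra.TensorProduct.one_def]
  have hβ := coorbit_adjBeta_mul (ι := ι) hSt hΔM he00 he01 he10 he11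
  have hα := coorbit_adjAlpha_mul (ι := ι) hSt hΔM he00 he01 he10 he11
  have hβ1 : coorbit e (adjBeta ΔM ι St) 1 = 1 := by
    simp [coorbit, adjBeta, Algebra.TensorProduct.one_def, hSt1]
  have hα1 : coorbit e (adjAlpha ΔM ι St) 1 = 1 := by
    simp [coorbit, adjAlpha, Algebra.TensorProduct.one_def, hSt1]
  have hmove (p y z : G) : p * dInv * y * z = p * y * (z * dInv) := by
    rw [← (hu z).eq, mul_assoc p, (hu y).eq]
    simp only [mul_assoc]
  obtain ⟨hrangeβ, hkerβ⟩ := range_and_ker_of_quasiCommute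
    (r := (q ^ 4)⁻¹) (s := (q ^ 2)⁻¹) (κa := ξ1) (κb := ξ1) (κc := -q * ξ1) (κd := -q * ξ1)
    (f := coorbit e (adjBeta ΔM ι St))
    hq hab hac hbc hbd hcd had hgen' (by simp [hq]) (by simp [hq]) hCD (hu _) (hu _) hli hβ1
    hξ1 hξ1 (by simp [hq, hξ1]) rfl (by field_simp)
    (fun h => by rw [hβ, hSa, hmove])
    (fun h => by rw [hβ, hSa, hmove])
    (fun h => by rw [hβ, hSc, smul_mul_assoc, smul_mul_assoc, hmove, smul_smul, mul_comm])
    (fun h => by rw [hβ, hSc, smul_mul_assoc, smul_mul_assoc, hmove, smul_smul, mul_comm])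
  obtain ⟨hrangeα, hkerα⟩ := range_and_ker_of_quasiCommute
    (a := MulOpposite.op (x 1 1)) (b := MulOpposite.op (x 0 1)) (c := MulOpposite.op (x 1 0))
    (d := MulOpposite.op (x 0 0))
    (r := 1) (s := 1) (κa := -q * ξ1) (κb := ξ1) (κc := -q * ξ1) (κd := ξ1)
    (f := coorbit e (adjAlpha ΔM ι St) ∘ₗ (MulOpposite.opLinearEquiv ℂ (M := M)).symm.toLinearMap)
    hq (congrArg MulOpposite.op hbd) (congrArg MulOpposite.op hcd)
    (congrArg MulOpposite.op hbc.symm) (congrArg MulOpposite.op hab)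
    (congrArg MulOpposite.op hac)
    (by simpa [hbc] using congrArg MulOpposite.op had)
    (adjoin_op_eq_top hgen')
    one_ne_zero one_ne_zero hCD (hu _) (hu _) hli (by simpa using hα1)
    (by simp [hq, hξ1]) hξ1 (by simp [hq, hξ1]) (by ring) (by ring)
    (fun h => by simp [hα, hSc, smul_smul, mul_comm])
    (fun h => by simp [hα, hSa])
    (fun h => by simp [hα, hSc, smul_smul, mul_comm])
    (fun h => by simp [hα, hSa])
  rw [range_eq_of_op] at hrangeα
  refine ⟨?_, fun f hf => ?_, hkerβ, ?_, ker_eq_span_left_of_op hkerα hbc⟩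
  · rw [← LinearMap.coe_range, hrangeβ, Subalgebra.coe_toSubmodule]
  · refine comul_mem_range_of_mem_adjoin (a := ι (x 0 0)) (b := ι (x 0 1)) hq hCD ?_ ?_ hΔu hf
    · simpa using hΔ 1 0
    · simpa using hΔ 1 1
  · rw [← LinearMap.coe_range, hrangeα, Subalgebra.coe_toSubmodule]

end
end

section
/- Let R be a finitely generated commutative polynomial algebra over a field K, with the usual grading, and for r ∈ R write r = r̄ + r̂, where r̄ is the highest-degree homogeneous component of r. Let u₁, …, u_N ∈ R be such that ū₁, …, ū_N is a regular sequence in R. Then for every f in the ideal generated by u₁, …, u_N, there exist f₁, …, f_N ∈ R with f = Σ_{i=1}^N u_i f_i and deg(u_i f_i) ≤ deg(f) for all i = 1, …, N. -/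
open TensorProduct

noncomputable section

namespace MvPolynomial

variable {σ R : Type*} [CommRing R]

theorem homogeneousComponent_mul_of_totalDegree_le {p q : MvPolynomial σ R} {a b : ℕ}
    (hp : p.totalDegree ≤ a) (hq : q.totalDegree ≤ b) :
    homogeneousComponent (a + b) (p * q) =
      homogeneousComponent a p * homogeneousComponent b q := by
  classical
  ext d
  rw [coeff_homogeneousComponent, coeff_mul, coeff_mul]
  have key : ∀ x ∈ Finset.HasAntidiagonal.antidiagonal d,
      coeff x.1 (homogeneousComponent a p) * coeff x.2 (homogeneousComponent b q) =
        if d.degree = a + b then coeff x.1 p * coeff x.2 q else 0 := by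
    rintro ⟨x, y⟩ hxy
    obtain rfl : x + y = d := by simpa using hxy
    simp only [coeff_homogeneousComponent, map_add]
    by_cases hx : coeff x p = 0
    · simp [hx]
    by_cases hy : coeff y q = 0
    · simp [hy]
    have hxa : x.degree ≤ a := (le_totalDegree (mem_support_iff.mpr hx)).trans hp
    have hyb : y.degree ≤ b := (le_totalDegree (mem_support_iff.mpr hy)).trans hq
    by_cases h : x.degree + y.degree = a + b
    · rw [if_pos h, if_pos (by omega), if_pos (by omega)]
    · rw [if_neg h]
      by_cases h' : x.degree = a
      · rw [if_neg (show ¬ y.degree = b by omega), mul_zero]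
      · rw [if_neg h', zero_mul]
  rw [Finset.sum_congr rfl key]
  split_ifs <;> simp

theorem IsHomogeneous.homogeneousComponent_mul {p : MvPolynomial σ R} {a k : ℕ}
    (hp : p.IsHomogeneous a) (q : MvPolynomial σ R) :
    homogeneousComponent k (p * q) =
      if a ≤ k then p * homogeneousComponent (k - a) q else 0 := by
  let _ : GradedAlgebra (homogeneousSubmodule σ R) := gradedAlgebra
  have h (r : MvPolynomial σ R) (i : ℕ) :
      (DirectSum.decompose (homogeneousSubmodule σ R) r i : MvPolynomial σ R) =
        homogeneousComponent i r := decomposition.decompose'_apply r i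
  split_ifs with hak
  · rw [← h, ← h, DirectSum.coe_decompose_mul_of_left_mem_of_le (homogeneousSubmodule σ R) hp hak]
  · rw [← h, DirectSum.coe_decompose_mul_of_left_mem_of_not_le (homogeneousSubmodule σ R) hp hak]

theorem eq_zero_of_homogeneousComponent_totalDegree {p : MvPolynomial σ R}
    (h : homogeneousComponent p.totalDegree p = 0) : p = 0 := by
  by_contra hp
  obtain ⟨d, hd, hdeg⟩ := Finset.exists_mem_eq_sup p.support (support_nonempty.mpr hp)
    fun s => s.sum fun _ e => e
  have := congrArg (coeff d) h
  rw [coeff_homogeneousComponent, if_pos, coeff_zero] at this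
  · exact mem_support_iff.mp hd this
  · exact hdeg.symm

/-- A component of an element of the ideal of leading forms is the leading form of an element
of the ideal itself. -/
theorem exists_mem_span_homogeneousComponent_eq {ι : Type*} [Finite ι]
    (u : ι → MvPolynomial σ R) {q : MvPolynomial σ R}
    (hq : q ∈ Ideal.span (Set.range fun j => homogeneousComponent (u j).totalDegree (u j)))
    (k : ℕ) :
    ∃ a ∈ Ideal.span (Set.range u), a.totalDegree ≤ k ∧
      homogeneousComponent k a = homogeneousComponent k q := by
  have := Fintype.ofFinite ι
  obtain ⟨r, rfl⟩ := Ideal.mem_span_range_iff_exists_fun.mp hq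
  have hterm (j : ι) : ∃ a ∈ Ideal.span (Set.range u), a.totalDegree ≤ k ∧
      homogeneousComponent k a =
        homogeneousComponent k (r j * homogeneousComponent (u j).totalDegree (u j)) := by
    rw [mul_comm (r j), (homogeneousComponent_isHomogeneous _ _).homogeneousComponent_mul]
    split_ifs with hk
    · have hd : (homogeneousComponent (k - (u j).totalDegree) (r j)).totalDegree ≤
          k - (u j).totalDegree := (homogeneousComponent_isHomogeneous _ _).totalDegree_le
      refine ⟨u j * homogeneousComponent (k - (u j).totalDegree) (r j),
        Ideal.mul_mem_right _ _ (Ideal.subset_span ⟨j, rfl⟩),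
        (totalDegree_mul _ _).trans (by omega), ?_⟩
      conv_lhs => arg 1; rw [← Nat.add_sub_cancel' hk]
      rw [homogeneousComponent_mul_of_totalDegree_le le_rfl hd,
        homogeneousComponent_eq_self (homogeneousComponent_isHomogeneous _ _)]
    · exact ⟨0, zero_mem _, by simp, by simp⟩
  choose a ha had hac using hterm
  exact ⟨∑ j, a j, sum_mem fun j _ => ha j, totalDegree_finsetSum_le fun j _ => had j,
    by simp only [map_sum, hac]⟩

theorem homogeneousComponent_mul_mem_span [IsDomain R] {u c : MvPolynomial σ R} {e : ℕ}
    (h : (u * c).totalDegree ≤ e) :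
    homogeneousComponent e (u * c) ∈ Ideal.span {homogeneousComponent u.totalDegree u} := by
  by_cases hu : u = 0
  · simp [hu]
  by_cases hc : c = 0
  · simp [hc]
  rcases h.lt_or_eq with h | rfl
  · rw [homogeneousComponent_eq_zero _ _ h]
    exact zero_mem _
  · rw [totalDegree_mul_of_isDomain hu hc, homogeneousComponent_mul_of_totalDegree_le le_rfl le_rfl]
    exact Ideal.mul_mem_right _ _ (Ideal.mem_span_singleton_self _)

/-- The inductive step: the conclusion for the first members of a family extends to one further
polynomial whose leading form is regular modulo the previous leading forms. -/
theorem exists_eq_add_mul_of_isRegular_leadingForm [IsDomain R] {ι : Type*} [Fintype ι]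
    (u : ι → MvPolynomial σ R) (v : MvPolynomial σ R)
    (hu : ∀ g ∈ Ideal.span (Set.range u), ∃ c : ι → MvPolynomial σ R,
      g = ∑ i, u i * c i ∧ ∀ i, (u i * c i).totalDegree ≤ g.totalDegree)
    (hv : ∀ r, homogeneousComponent v.totalDegree v * r ∈
        Ideal.span (Set.range fun j => homogeneousComponent (u j).totalDegree (u j)) →
      r ∈ Ideal.span (Set.range fun j => homogeneousComponent (u j).totalDegree (u j)))
    (f g h : MvPolynomial σ R) (hg : g ∈ Ideal.span (Set.range u)) (hf : f = g + v * h) :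
    ∃ g' ∈ Ideal.span (Set.range u), ∃ h', f = g' + v * h' ∧
      (v * h').totalDegree ≤ f.totalDegree := by
  suffices H : ∀ (k : ℕ) (g h : MvPolynomial σ R), h = 0 ∨ h.totalDegree < k →
      g ∈ Ideal.span (Set.range u) → f = g + v * h →
      ∃ g' ∈ Ideal.span (Set.range u), ∃ h', f = g' + v * h' ∧
        (v * h').totalDegree ≤ f.totalDegree from
    H (h.totalDegree + 1) g h (Or.inr (Nat.lt_succ_self _)) hg hf
  clear hf hg h g
  intro k
  induction k with
  | zero =>
    intro g h hh hg hf
    obtain rfl : h = 0 := by simpa using hh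
    exact ⟨g, hg, 0, hf, by simp⟩
  | succ k ih =>
    intro g h hh hg hf
    by_cases hle : (v * h).totalDegree ≤ f.totalDegree
    · exact ⟨g, hg, h, hf, hle⟩
    rw [not_le] at hle
    have hv0 : v ≠ 0 := by rintro rfl; simp at hle
    have hh0 : h ≠ 0 := by rintro rfl; simp at hle
    have hk : h.totalDegree < k + 1 := hh.resolve_left hh0
    have hdeg := totalDegree_mul_of_isDomain hv0 hh0
    have hgf : g = f - v * h := by rw [hf]; ring
    have hgle : g.totalDegree ≤ (v * h).totalDegree := by
      rw [hgf]
      exact (totalDegree_sub _ _).trans (max_le hle.le le_rfl)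
    have hgmem : homogeneousComponent (v * h).totalDegree g ∈
        Ideal.span (Set.range fun j => homogeneousComponent (u j).totalDegree (u j)) := by
      obtain ⟨c, hc, hcd⟩ := hu g hg
      rw [hc, map_sum]
      refine sum_mem fun i _ => ?_
      refine Ideal.span_mono ?_ (homogeneousComponent_mul_mem_span ((hcd i).trans hgle))
      rintro _ rfl
      exact ⟨i, rfl⟩
    have hhmem : homogeneousComponent h.totalDegree h ∈
        Ideal.span (Set.range fun j => homogeneousComponent (u j).totalDegree (u j)) := by
      apply hv
      rw [hgf, map_sub, homogeneousComponent_eq_zero _ _ hle, zero_sub, neg_mem_iff, hdeg,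
        homogeneousComponent_mul_of_totalDegree_le le_rfl le_rfl] at hgmem
      exact hgmem
    obtain ⟨a, ha, had, hac⟩ := exists_mem_span_homogeneousComponent_eq u hhmem h.totalDegree
    rw [homogeneousComponent_eq_self (homogeneousComponent_isHomogeneous _ _)] at hac
    refine ih (g + v * a) (h - a) ?_ (add_mem hg (Ideal.mul_mem_left _ _ ha)) (by rw [hf]; ring)
    have hle' : (h - a).totalDegree ≤ h.totalDegree :=
      (totalDegree_sub _ _).trans (max_le le_rfl had)
    rcases hle'.lt_or_eq with hlt | heq
    · exact Or.inr (by omega)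
    · refine Or.inl (eq_zero_of_homogeneousComponent_totalDegree ?_)
      rw [heq, map_sub, hac, sub_self]

end MvPolynomial

/-- If the top homogeneous components of `u₁, …, u_N` form a regular sequence, then
every element of the ideal `(u₁, …, u_N)` has an expression `f = Σ uᵢ fᵢ` with
`deg(uᵢ fᵢ) ≤ deg f`. -/
theorem ideal_membership_with_degree_bound
    {K : Type} [Field K] {n Nn : ℕ}
    (u : Fin Nn → MvPolynomial (Fin n) K)
    (hreg : ∀ (i : Fin Nn) (r : MvPolynomial (Fin n) K),
      MvPolynomial.homogeneousComponent (u i).totalDegree (u i) * r ∈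
        Ideal.span ((fun j : Fin Nn =>
          MvPolynomial.homogeneousComponent (u j).totalDegree (u j)) '' {j | j < i}) →
      r ∈ Ideal.span ((fun j : Fin Nn =>
        MvPolynomial.homogeneousComponent (u j).totalDegree (u j)) '' {j | j < i}))
    (f : MvPolynomial (Fin n) K) (hf : f ∈ Ideal.span (Set.range u)) :
    ∃ c : Fin Nn → MvPolynomial (Fin n) K,
      f = ∑ i, u i * c i ∧ ∀ i, (u i * c i).totalDegree ≤ f.totalDegree := by
  induction Nn generalizing f with
  | zero =>
    have hf0 : f = 0 := by simpa using hf
    exact ⟨Fin.elim0, by simpa using hf0, fun i => i.elim0⟩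
  | succ m ih =>
    have hcast (i : Fin m) : (fun j : Fin (m + 1) =>
          MvPolynomial.homogeneousComponent (u j).totalDegree (u j)) '' {j | j < i.castSucc} =
        (fun j : Fin m => MvPolynomial.homogeneousComponent
          (u j.castSucc).totalDegree (u j.castSucc)) '' {j | j < i} := by
      ext p
      constructor
      · rintro ⟨j, hj, rfl⟩
        have hjm : j.val < m := lt_trans (show j.val < i.val from hj) i.isLt
        exact ⟨⟨j, hjm⟩, hj, rfl⟩
      · rintro ⟨j, hj, rfl⟩
        exact ⟨j.castSucc, hj, rfl⟩
    have hlast : (fun j : Fin (m + 1) =>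
          MvPolynomial.homogeneousComponent (u j).totalDegree (u j)) '' {j | j < Fin.last m} =
        Set.range fun j : Fin m => MvPolynomial.homogeneousComponent
          (u j.castSucc).totalDegree (u j.castSucc) := by
      ext p
      constructor
      · rintro ⟨j, hj, rfl⟩
        exact ⟨⟨j, hj⟩, rfl⟩
      · rintro ⟨j, rfl⟩
        exact ⟨j.castSucc, j.castSucc_lt_last, rfl⟩
    have hu := ih (fun j => u j.castSucc) fun i r => by
      simpa only [hcast] using hreg i.castSucc r
    obtain ⟨c, hc⟩ := Ideal.mem_span_range_iff_exists_fun.mp hf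
    rw [Fin.sum_univ_castSucc, mul_comm (c (Fin.last m))] at hc
    obtain ⟨g, hg, h, hfgh, hdeg⟩ := MvPolynomial.exists_eq_add_mul_of_isRegular_leadingForm
      (fun j : Fin m => u j.castSucc) (u (Fin.last m)) hu
      (fun r => by simpa only [hlast] using hreg (Fin.last m) r) f _ _
      (Ideal.mem_span_range_iff_exists_fun.mpr ⟨fun j => c j.castSucc, rfl⟩) hc.symm
    obtain ⟨b, hb, hbd⟩ := hu g hg
    have hgle : g.totalDegree ≤ f.totalDegree := by
      rw [show g = f - u (Fin.last m) * h by rw [hfgh]; ring]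
      exact (MvPolynomial.totalDegree_sub _ _).trans (max_le le_rfl hdeg)
    refine ⟨Fin.snoc b h, ?_, fun i => ?_⟩
    · rw [Fin.sum_univ_castSucc]
      simpa only [Fin.snoc_castSucc, Fin.snoc_last, ← hb] using hfgh
    · induction i using Fin.lastCases with
      | last => simpa only [Fin.snoc_last] using hdeg
      | cast i => simpa only [Fin.snoc_castSucc] using (hbd i).trans hgle
end
end
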